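/- Let P=(V,C) be a CSP instance whose domains A_v are finite idempotent algebras of a common signature and whose constraint relations are invariant under the coordinatewise action of every common term operation. Let x·y be a binary term operation such that x·y is a semilattice operation on every semilattice edge and for all elements a,b of any domain either a·b=a or {a,a·b} is a semilattice edge. For each v∈V let μ*_v be a congruence of A_v such that either μ*_v = 0_v or the centralizer satisfies (0_v:μ*_v)=1_v. Let φ be a solution of the quotient instance P/μ̄*, and for each v choose b_v ∈ φ(v) and set q_v(x)=x·b_v. Then for every m ≥ 1 the mappings (q_v^m)_{v∈V} are consistent for P; in particular, choosing k so that q_v^k is idempotent for all v, the mappings p^φ_v = q_v^k are consistent idempotent mappings, and they do not depend on the choice of the representatives b_v ∈ φ(v). -/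

import Mathlib

/- ## Universal-algebra preliminaries -/

/-- A signature: a set of operation symbols with arities. -/
structure Signature where
  ι : Type
  arity : ι → ℕ

/-- An algebra with signature `σ` on the carrier `A`: an interpretation of the
basic operation symbols. -/
structure AlgOn (σ : Signature) (A : Type) where
  op : ∀ i : σ.ι, (Fin (σ.arity i) → A) → A

/-- Syntactic terms of signature `σ` in `n` variables. -/
inductive Term (σ : Signature) (n : ℕ) where
  | var : Fin n → Term σ n
  | app : (i : σ.ι) → (Fin (σ.arity i) → Term σ n) → Term σ n

/-- The term operation of an algebra given by a term. -/
def Term.eval {σ : Signature} {A : Type} (𝔸 : AlgOn σ A) {n : ℕ} :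
    Term σ n → (Fin n → A) → A
  | .var j, x => x j
  | .app i ts, x => 𝔸.op i (fun j => (ts j).eval 𝔸 x)

/-- An algebra is idempotent if every basic operation satisfies `f(x,...,x)=x`. -/
def AlgOn.Idem {σ : Signature} {A : Type} (𝔸 : AlgOn σ A) : Prop :=
  ∀ (i : σ.ι) (a : A), 𝔸.op i (fun _ => a) = a

/-- A congruence: an equivalence relation preserved by all basic operations. -/
structure IsCongruence {σ : Signature} {A : Type} (𝔸 : AlgOn σ A) (θ : A → A → Prop) : Prop where
  equiv : Equivalence θ
  preserved : ∀ (i : σ.ι) (x y : Fin (σ.arity i) → A),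
    (∀ j, θ (x j) (y j)) → θ (𝔸.op i x) (𝔸.op i y)

/-- The full (total) binary relation on `A`. -/
def fullRel (A : Type) : A → A → Prop := fun _ _ => True

/-- `{a,b}` is a semilattice edge (with top `b`): some binary term operation `f`
satisfies `f(a,a)=a` and `f(a,b)=f(b,a)=f(b,b)=b`. -/
def SemilatticeEdge {σ : Signature} {A : Type} (𝔸 : AlgOn σ A) (a b : A) : Prop :=
  a ≠ b ∧ ∃ t : Term σ 2, t.eval 𝔸 ![a, a] = a ∧ t.eval 𝔸 ![a, b] = b ∧
    t.eval 𝔸 ![b, a] = b ∧ t.eval 𝔸 ![b, b] = b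

/-- An algebra is semilattice free if it contains no semilattice edge. -/
def SemilatticeFree {σ : Signature} {A : Type} (𝔸 : AlgOn σ A) : Prop :=
  ∀ a b : A, ¬ SemilatticeEdge 𝔸 a b

/-- `CentralizerCond 𝔸 α β δ` states that `δ` satisfies the defining property of the
centralizer `(α:β)`: for every term operation `f(x,y₁,...,yₖ)` and all tuples
`a,b` related componentwise by `δ`, `f(·,a)(β) ⊆ α ↔ f(·,b)(β) ⊆ α`.
Since this property is downward closed in `δ` and `(α:β)` is the greatest
congruence satisfying it, for a congruence `δ` one has `(α:β) ≥ δ` iff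
`CentralizerCond 𝔸 α β δ`; in particular `(α:β) = 1` iff
`CentralizerCond 𝔸 α β (fullRel A)`. -/
def CentralizerCond {σ : Signature} {A : Type} (𝔸 : AlgOn σ A) (α β δ : A → A → Prop) : Prop :=
  ∀ (k : ℕ) (t : Term σ (k + 1)) (a b : Fin k → A), (∀ i, δ (a i) (b i)) →
    ((∀ u v, β u v → α (t.eval 𝔸 (Fin.cons u a)) (t.eval 𝔸 (Fin.cons v a))) ↔
     (∀ u v, β u v → α (t.eval 𝔸 (Fin.cons u b)) (t.eval 𝔸 (Fin.cons v b))))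

/-- `ζ` is the centralizer `(α:β)`: the greatest congruence satisfying the
centralizer condition. -/
def IsCentralizer {σ : Signature} {A : Type} (𝔸 : AlgOn σ A) (α β ζ : A → A → Prop) : Prop :=
  IsCongruence 𝔸 ζ ∧ CentralizerCond 𝔸 α β ζ ∧
  ∀ ζ' : A → A → Prop, IsCongruence 𝔸 ζ' → CentralizerCond 𝔸 α β ζ' → ∀ x y, ζ' x y → ζ x y

/-- `μ` is the monolith of `𝔸`: the least congruence distinct from equality.
An algebra having a monolith is subdirectly irreducible. -/
structure IsMonolith {σ : Signature} {A : Type} (𝔸 : AlgOn σ A) (μ : A → A → Prop) : Prop where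
  congr : IsCongruence 𝔸 μ
  nontrivial : ∃ a b, μ a b ∧ a ≠ b
  least : ∀ θ : A → A → Prop, IsCongruence 𝔸 θ → (∃ a b, θ a b ∧ a ≠ b) → ∀ a b, μ a b → θ a b

/-- `α ≺ β`: a prime interval in the congruence lattice. -/
def PrimeInterval {σ : Signature} {A : Type} (𝔸 : AlgOn σ A) (α β : A → A → Prop) : Prop :=
  IsCongruence 𝔸 α ∧ IsCongruence 𝔸 β ∧ (∀ x y, α x y → β x y) ∧ α ≠ β ∧
  ∀ γ : A → A → Prop, IsCongruence 𝔸 γ → (∀ x y, α x y → γ x y) → (∀ x y, γ x y → β x y) →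
    γ = α ∨ γ = β

/-- A weak near-unanimity operation. -/
def IsWNUOp {A : Type} (n : ℕ) (w : (Fin n → A) → A) : Prop :=
  (∀ a, w (fun _ => a) = a) ∧
  ∀ (a b : A) (i j : Fin n),
    w (Function.update (fun _ => a) i b) = w (Function.update (fun _ => a) j b)

/-- The algebra has a weak near-unanimity term operation. -/
def HasWNUTerm {σ : Signature} {A : Type} (𝔸 : AlgOn σ A) : Prop :=
  ∃ n : ℕ, 2 ≤ n ∧ ∃ t : Term σ n, IsWNUOp n (t.eval 𝔸)

/-- A unary polynomial: a term operation with all but one argument fixed to constants. -/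
def IsUnaryPolynomial {σ : Signature} {A : Type} (𝔸 : AlgOn σ A) (f : A → A) : Prop :=
  ∃ (k : ℕ) (t : Term σ (k + 1)) (c : Fin k → A), ∀ x, f x = t.eval 𝔸 (Fin.cons x c)

/-- Membership in the subalgebra generated by `S`. -/
inductive InSg {σ : Signature} {A : Type} (𝔸 : AlgOn σ A) (S : Set A) : A → Prop where
  | base : ∀ a ∈ S, InSg 𝔸 S a
  | app : ∀ (i : σ.ι) (x : Fin (σ.arity i) → A), (∀ j, InSg 𝔸 S (x j)) → InSg 𝔸 S (𝔸.op i x)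

/-- The quotient algebra modulo a setoid (intended: a congruence). -/
noncomputable def AlgOn.quotAlg {σ : Signature} {A : Type} (𝔸 : AlgOn σ A) (θ : Setoid A) :
    AlgOn σ (Quotient θ) :=
  ⟨fun i x => Quotient.mk θ (𝔸.op i fun j => (x j).out)⟩

/-- `𝔹` is (isomorphic to) a subalgebra of a quotient algebra of `𝔸`. -/
def IsSubalgebraOfQuotient {σ : Signature} {A B : Type} (𝔸 : AlgOn σ A) (𝔹 : AlgOn σ B) :
    Prop :=
  ∃ θ : Setoid A, IsCongruence 𝔸 θ.r ∧
    ∃ e : B → Quotient θ, Function.Injective e ∧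
      ∀ (i : σ.ι) (x : Fin (σ.arity i) → B),
        e (𝔹.op i x) = (𝔸.quotAlg θ).op i fun j => e (x j)

/-- The algebra on the image of `p` with operations `p ∘ f`. -/
def retractAlg {σ : Signature} {B : Type} (𝔹 : AlgOn σ B) (p : B → B) :
    AlgOn σ {x // x ∈ Set.range p} :=
  ⟨fun i x => ⟨p (𝔹.op i fun j => (x j).1), Set.mem_range_self _⟩⟩

/- ## CSP preliminaries -/

/-- A constraint over variables `V` with domains `A`, represented by its scope and a
cylindrical relation (a relation on full assignments depending only on the scope). -/
structure Constraint (V : Type) (A : V → Type) where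
  scope : Set V
  rel : Set (∀ v, A v)
  cyl : ∀ φ ψ : ∀ v, A v, (∀ v ∈ scope, φ v = ψ v) → φ ∈ rel → ψ ∈ rel

/-- A CSP instance: a finite list of constraints. -/
structure CSP (V : Type) (A : V → Type) where
  cons : List (Constraint V A)

def CSP.IsSolution {V : Type} {A : V → Type} (P : CSP V A) (φ : ∀ v, A v) : Prop :=
  ∀ C ∈ P.cons, φ ∈ C.rel

/-- `ψ` (more precisely, its restriction to `W`) is a solution of the restricted
instance `P_W`. -/
def CSP.PartialSol {V : Type} {A : V → Type} (P : CSP V A) (W : Set V) (ψ : ∀ v, A v) : Prop :=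
  ∀ C ∈ P.cons, ∃ a ∈ C.rel, ∀ v ∈ C.scope ∩ W, ψ v = a v

/-- `R^{uw}`: the set of solutions of the restriction of `P` to `{u,w}`. -/
def CSP.pairRel {V : Type} {A : V → Type} (P : CSP V A) (u w : V) : Set (A u × A w) :=
  { p | ∃ ψ : ∀ x, A x, P.PartialSol {u, w} ψ ∧ ψ u = p.1 ∧ ψ w = p.2 }

/-- (2,3)-minimality: the instance contains, for each at most 2-element set of
variables, a constraint whose relation is the corresponding set of partial
solutions; these relations form a (2,3)-strategy; and every tuple of every
constraint relation projects into them. -/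
def CSP.TwoThreeMinimal {V : Type} {A : V → Type} (P : CSP V A) : Prop :=
  (∀ u w : V, ∃ C ∈ P.cons, C.scope = {u, w} ∧ C.rel = { φ | P.PartialSol {u, w} φ }) ∧
  (∀ u v w : V, w ≠ u → w ≠ v →
    ∀ p ∈ P.pairRel u v, ∃ c : A w, (p.1, c) ∈ P.pairRel u w ∧ (p.2, c) ∈ P.pairRel v w) ∧
  (∀ C ∈ P.cons, ∀ a ∈ C.rel, ∀ u ∈ C.scope, ∀ w ∈ C.scope, (a u, a w) ∈ P.pairRel u w)

/-- A minimal (globally minimal) instance: every tuple of every constraint relation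
extends to a solution. -/
def CSP.Minimal {V : Type} {A : V → Type} (P : CSP V A) : Prop :=
  ∀ C ∈ P.cons, ∀ a ∈ C.rel, ∃ φ, P.IsSolution φ ∧ ∀ v ∈ C.scope, φ v = a v

/-- A binary relation is `αγ`-aligned: `(a,b) ∈ α ↔ (c,d) ∈ γ` for `(a,c),(b,d)` in it. -/
def Aligned {X Y : Type} (R : Set (X × Y)) (α : X → X → Prop) (γ : Y → Y → Prop) : Prop :=
  ∀ p ∈ R, ∀ q ∈ R, (α p.1 q.1 ↔ γ p.2 q.2)

/-- `B` is a block (equivalence class) of `α`. -/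
def IsBlock {X : Type} (α : X → X → Prop) (B : Set X) : Prop :=
  ∃ a, B = { x | α a x }

/-- `W` is a strand of `P` with respect to the congruences `α_v` (`v ∈ W`). -/
def IsStrand {σ : Signature} {V : Type} {A : V → Type} (P : CSP V A)
    (𝔹 : ∀ v, AlgOn σ (A v)) (W : Set V) (α : ∀ v, A v → A v → Prop) : Prop :=
  (∀ v ∈ W, IsCongruence (𝔹 v) (α v)) ∧
  ∀ v ∈ W, ∀ w ∈ W, Aligned (P.pairRel v w) (α v) (α w)

/-- The quotient of a constraint modulo a family of setoids. -/
def Constraint.quot {V : Type} {A : V → Type} (C : Constraint V A) (s : ∀ v, Setoid (A v)) :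
    Constraint V (fun v => Quotient (s v)) where
  scope := C.scope
  rel := { φ | ∃ a ∈ C.rel, ∀ v ∈ C.scope, φ v = Quotient.mk (s v) (a v) }
  cyl := by
    intro φ ψ h hφ
    obtain ⟨a, ha, h2⟩ := hφ
    exact ⟨a, ha, fun v hv => (h v hv).symm.trans (h2 v hv)⟩

/-- The quotient instance `P/ᾱ`. -/
def CSP.quot {V : Type} {A : V → Type} (P : CSP V A) (s : ∀ v, Setoid (A v)) :
    CSP V (fun v => Quotient (s v)) :=
  ⟨P.cons.map (fun C => C.quot s)⟩

open Classical in
/-- The family of setoids `μ^Y`: `μ_v` for `v ∈ Y` and equality otherwise. -/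
noncomputable def muSetoid {V : Type} {A : V → Type} (μ : ∀ v, A v → A v → Prop)
    (hμ : ∀ v, Equivalence (μ v)) (Y : Set V) : ∀ v, Setoid (A v) :=
  fun v => if v ∈ Y then ⟨μ v, hμ v⟩ else ⟨Eq, eq_equivalence⟩

open Classical in
/-- `size(P)`: the largest size of a domain that is not semilattice free. -/
noncomputable def CSP.sizeP {σ : Signature} {V : Type} [Fintype V] {A : V → Type}
    (P : CSP V A) (𝔹 : ∀ v, AlgOn σ (A v)) : ℕ :=
  Finset.univ.sup fun v => if SemilatticeFree (𝔹 v) then 0 else Nat.card (A v)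

/-- `MAX(P)`: the variables whose domain is not semilattice free and has size `size(P)`. -/
def CSP.MAXset {σ : Signature} {V : Type} [Fintype V] {A : V → Type}
    (P : CSP V A) (𝔹 : ∀ v, AlgOn σ (A v)) : Set V :=
  { v | ¬ SemilatticeFree (𝔹 v) ∧ Nat.card (A v) = P.sizeP 𝔹 }

/-- Block-minimality: for every strand `W` the instance `P_{/W} = P/μ^{MAX(P)−W}` is
minimal. -/
def CSP.BlockMinimal {σ : Signature} {V : Type} [Fintype V] {A : V → Type}
    (P : CSP V A) (𝔹 : ∀ v, AlgOn σ (A v))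
    (μ : ∀ v, A v → A v → Prop) (hμ : ∀ v, Equivalence (μ v)) : Prop :=
  ∀ (W : Set V) (α : ∀ v, A v → A v → Prop), IsStrand P 𝔹 W α →
    (P.quot (muSetoid μ hμ (P.MAXset 𝔹 \ W))).Minimal

/-- The constraint relation is invariant under the coordinatewise action of every
common term operation of the domain algebras. -/
def Constraint.Invariant {σ : Signature} {V : Type} {A : V → Type}
    (C : Constraint V A) (𝔹 : ∀ v, AlgOn σ (A v)) : Prop :=
  ∀ (n : ℕ) (t : Term σ n) (φ : Fin n → ∀ v, A v),
    (∀ j, φ j ∈ C.rel) → (fun v => t.eval (𝔹 v) fun j => φ j v) ∈ C.rel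

/-- The constraint relation is preserved by the family of `n`-ary operations `w`. -/
def Constraint.InvariantUnder {V : Type} {A : V → Type} (C : Constraint V A) (n : ℕ)
    (w : ∀ v, (Fin n → A v) → A v) : Prop :=
  ∀ φ : Fin n → ∀ v, A v, (∀ j, φ j ∈ C.rel) → (fun v => w v fun j => φ j v) ∈ C.rel

/-- A family of mappings `p_v : A_v → A_v` is consistent for `P`. -/
def ConsistentMaps {V : Type} {A : V → Type} (P : CSP V A) (p : ∀ v, A v → A v) : Prop :=
  ∀ C ∈ P.cons, ∀ a ∈ C.rel, (fun v => p v (a v)) ∈ C.rel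

/-- The retraction of `P` to the images of the mappings `p_v`. -/
def CSP.retract {V : Type} {A : V → Type} (P : CSP V A) (p : ∀ v, A v → A v) :
    CSP V (fun v => {x // x ∈ Set.range (p v)}) :=
  ⟨P.cons.map fun C =>
    { scope := C.scope
      rel := { φ | (fun v => (φ v).1) ∈ C.rel }
      cyl := fun φ ψ h hφ =>
        C.cyl _ _ (fun v hv => congrArg Subtype.val (h v hv)) hφ }⟩

/-- The restriction of a constraint to a set `W` of variables. -/
def Constraint.restrict {V : Type} {A : V → Type} (C : Constraint V A) (W : Set V) :
    Constraint V A where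
  scope := C.scope ∩ W
  rel := { φ | ∃ a ∈ C.rel, ∀ v ∈ C.scope ∩ W, φ v = a v }
  cyl := by
    intro φ ψ h hφ
    obtain ⟨a, ha, h2⟩ := hφ
    exact ⟨a, ha, fun v hv => (h v hv).symm.trans (h2 v hv)⟩

/-- The restriction `P_W` of the instance `P` to the variables in `W`. -/
def CSP.restrict {V : Type} {A : V → Type} (P : CSP V A) (W : Set V) : CSP V A :=
  ⟨P.cons.map (fun C => C.restrict W)⟩

/-- The restriction of a constraint to `W`, additionally intersected with the
product of the sets `B_v`, `v ∈ W`. -/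
def Constraint.restrictBlocks {V : Type} {A : V → Type} (C : Constraint V A) (W : Set V)
    (B : ∀ v, Set (A v)) : Constraint V A where
  scope := C.scope ∩ W
  rel := { φ | (∃ a ∈ C.rel, ∀ v ∈ C.scope ∩ W, φ v = a v) ∧ ∀ v ∈ C.scope ∩ W, φ v ∈ B v }
  cyl := by
    intro φ ψ h hφ
    obtain ⟨⟨a, ha, h2⟩, h3⟩ := hφ
    exact ⟨⟨a, ha, fun v hv => (h v hv).symm.trans (h2 v hv)⟩,
      fun v hv => (h v hv) ▸ h3 v hv⟩

/-- The instance `P_W` with the domains of variables in `W` restricted to the sets `B_v`. -/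
def CSP.restrictBlocks {V : Type} {A : V → Type} (P : CSP V A) (W : Set V)
    (B : ∀ v, Set (A v)) : CSP V A :=
  ⟨P.cons.map (fun C => C.restrictBlocks W B)⟩

/-- The quotient of a constraint modulo `s`, keeping only (quotients of) tuples whose
`U`-coordinates lie in the chosen sets `B_w`. -/
def Constraint.quotRestrict {V : Type} {A : V → Type} (C : Constraint V A)
    (s : ∀ v, Setoid (A v)) (U : Set V) (B : ∀ v, Set (A v)) :
    Constraint V (fun v => Quotient (s v)) where
  scope := C.scope
  rel := { φ | ∃ a ∈ C.rel, (∀ w ∈ C.scope ∩ U, a w ∈ B w) ∧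
      ∀ v ∈ C.scope, φ v = Quotient.mk (s v) (a v) }
  cyl := by
    intro φ ψ h hφ
    obtain ⟨a, ha, h2, h3⟩ := hφ
    exact ⟨a, ha, h2, fun v hv => (h v hv).symm.trans (h3 v hv)⟩

/-- The quotient instance restricted to chosen blocks on `U`. -/
def CSP.quotRestrict {V : Type} {A : V → Type} (P : CSP V A) (s : ∀ v, Setoid (A v))
    (U : Set V) (B : ∀ v, Set (A v)) : CSP V (fun v => Quotient (s v)) :=
  ⟨P.cons.map (fun C => C.quotRestrict s U B)⟩

/-- `(α,β)` can be separated from `(γ,δ)` in the subdirect product `R ⊆ A₁ × A₂`: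
some unary polynomial `f` of `R` (a term operation of the product algebra with
parameters from `R`) satisfies `f(β) ⊄ α` and `f(δ) ⊆ γ`. -/
def CanSeparate {σ : Signature} {A₁ A₂ : Type} (𝔹₁ : AlgOn σ A₁) (𝔹₂ : AlgOn σ A₂)
    (R : Set (A₁ × A₂)) (α β : A₁ → A₁ → Prop) (γ δ : A₂ → A₂ → Prop) : Prop :=
  ∃ (k : ℕ) (t : Term σ (k + 1)) (c : Fin k → A₁ × A₂), (∀ j, c j ∈ R) ∧
    ¬ (∀ x y, β x y → α (t.eval 𝔹₁ (Fin.cons x fun j => (c j).1))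
        (t.eval 𝔹₁ (Fin.cons y fun j => (c j).1))) ∧
    (∀ x y, δ x y → γ (t.eval 𝔹₂ (Fin.cons x fun j => (c j).2))
        (t.eval 𝔹₂ (Fin.cons y fun j => (c j).2)))

/-- The coherent set `W(v,α,β)`: the variables `w` for which some prime interval
`γ ≺ δ` of `Con(A_w)` is such that `(α,β)` and `(γ,δ)` cannot be separated from
each other in `R^{vw}`. -/
def coherentSet {σ : Signature} {V : Type} {A : V → Type} (P : CSP V A)
    (𝔹 : ∀ v, AlgOn σ (A v)) (v : V) (α β : A v → A v → Prop) : Set V :=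
  { w | ∃ γ δ : A w → A w → Prop, PrimeInterval (𝔹 w) γ δ ∧
      ¬ CanSeparate (𝔹 v) (𝔹 w) (P.pairRel v w) α β γ δ ∧
      ¬ CanSeparate (𝔹 w) (𝔹 v) (P.pairRel w v) γ δ α β }

/-- The map sending an `s`-block to the `t`-block containing it (`s ≤ t`). -/
def Setoid.blockMap {X : Type} (s t : Setoid X) (h : ∀ a b, s.r a b → t.r a b) :
    Quotient s → Quotient t :=
  Quotient.lift (fun a => Quotient.mk t a) (fun a b hab => Quot.sound (h a b hab))

/-- Simultaneous substitution of terms for the variables of a term. -/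
def Term.subst {σ : Signature} {m n : ℕ} (s : Fin m → Term σ n) : Term σ m → Term σ n
  | .var j => s j
  | .app i ts => .app i fun j => (ts j).subst s

theorem Term.eval_subst {σ : Signature} {A : Type} (𝔸 : AlgOn σ A) {m n : ℕ}
    (s : Fin m → Term σ n) (t : Term σ m) (x : Fin n → A) :
    (t.subst s).eval 𝔸 x = t.eval 𝔸 fun j => (s j).eval 𝔸 x := by
  induction t with
  | var j => rfl
  | app i ts ih =>
    simp only [Term.subst, Term.eval]
    exact congrArg _ (funext ih)

theorem Term.eval_subst_pair {σ : Signature} {A : Type} (𝔸 : AlgOn σ A) {n : ℕ}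
    (t : Term σ 2) (r s : Term σ n) (x : Fin n → A) :
    (t.subst ![r, s]).eval 𝔸 x = t.eval 𝔸 ![r.eval 𝔸 x, s.eval 𝔸 x] := by
  rw [Term.eval_subst]
  congr 1
  funext j
  fin_cases j <;> rfl

theorem IsCongruence.eval {σ : Signature} {A : Type} {𝔸 : AlgOn σ A} {θ : A → A → Prop}
    (hθ : IsCongruence 𝔸 θ) {n : ℕ} (t : Term σ n) {x y : Fin n → A}
    (h : ∀ j, θ (x j) (y j)) : θ (t.eval 𝔸 x) (t.eval 𝔸 y) := by
  induction t with
  | var j => exact h j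
  | app i ts ih => exact hθ.preserved i _ _ ih

/-- The term `x₁ · (x₂ · (⋯ (xₖ · u)))`, where `u` is the variable with index `0`. -/
def Term.iterLeft {σ : Signature} (t : Term σ 2) (k : ℕ) : Term σ (k + 1) :=
  (List.finRange k).foldr (fun j w => t.subst ![.var j.succ, w]) (.var 0)

theorem Term.eval_iterLeft {σ : Signature} {A : Type} (𝔸 : AlgOn σ A) (t : Term σ 2) {k : ℕ}
    (u : A) (c : Fin k → A) :
    (t.iterLeft k).eval 𝔸 (Fin.cons u c) =
      ((List.finRange k).map c).foldr (fun a w => t.eval 𝔸 ![a, w]) u := by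
  unfold Term.iterLeft
  induction List.finRange k with
  | nil => rfl
  | cons j l ih =>
    simp only [List.foldr_cons, List.map_cons, Term.eval_subst_pair, ih]
    rfl

/-- In a finite groupoid with `xx = x` and `(xy)x = xy`, some composition of left
multiplications is constant on any given finite set. -/
theorem exists_foldr_const {A : Type} (m : A → A → A) (hid : ∀ a, m a a = a)
    (habs : ∀ a b, m (m a b) a = m a b) (T : Finset A) :
    ∃ l : List A, ∀ u ∈ T, ∀ v ∈ T, l.foldr m u = l.foldr m v := by
  classical
  induction hn : T.card using Nat.strong_induction_on generalizing T with
  | _ n ih =>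
    by_cases hT : T.card ≤ 1
    · exact ⟨[], fun u hu v hv => Finset.card_le_one.1 hT u hu v hv⟩
    · obtain ⟨s, hs, u, hu, hsu⟩ := Finset.one_lt_card.1 (not_le.1 hT)
      have hlt : (T.image fun w => m (m s u) (m s w)).card < n := by
        rw [← hn]
        refine lt_of_le_of_ne Finset.card_image_le fun h => hsu ?_
        refine Finset.card_image_iff.1 h hs hu ?_
        rw [hid s, habs, hid]
      obtain ⟨l, hl⟩ := ih _ hlt _ rfl
      refine ⟨l ++ [m s u, s], fun x hx y hy => ?_⟩
      simpa using hl _ (Finset.mem_image_of_mem _ hx) _ (Finset.mem_image_of_mem _ hy)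

/-- If `(0 : μ) = 1`, then right multiplication depends only on the `μ`-class of the factor. -/
theorem eval_eq_of_centralizerCond {σ : Signature} {A : Type} [Fintype A] {𝔸 : AlgOn σ A}
    {t : Term σ 2} (hid : ∀ a, t.eval 𝔸 ![a, a] = a)
    (habsl : ∀ a b, t.eval 𝔸 ![a, t.eval 𝔸 ![a, b]] = t.eval 𝔸 ![a, b])
    (habsr : ∀ a b, t.eval 𝔸 ![t.eval 𝔸 ![a, b], a] = t.eval 𝔸 ![a, b])
    {μ : A → A → Prop} (hμ : IsCongruence 𝔸 μ)
    (hcen : CentralizerCond 𝔸 Eq μ (fullRel A)) (a : A) {b c : A} (hbc : μ b c) :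
    t.eval 𝔸 ![a, b] = t.eval 𝔸 ![a, c] := by
  obtain ⟨l, hl⟩ := exists_foldr_const (fun a w => t.eval 𝔸 ![a, w]) hid habsr Finset.univ
  have h := (hcen l.length (t.iterLeft l.length) l.get (fun _ => a) fun _ => trivial).1
    fun u v _ => by
      rw [Term.eval_iterLeft, Term.eval_iterLeft, List.map_get_finRange]
      exact hl u (Finset.mem_univ _) v (Finset.mem_univ _)
  have hfix : ∀ d, (t.iterLeft l.length).eval 𝔸 (Fin.cons (t.eval 𝔸 ![a, d]) fun _ => a) =
      t.eval 𝔸 ![a, d] := by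
    intro d
    rw [Term.eval_iterLeft]
    induction List.finRange l.length with
    | nil => rfl
    | cons j l ih => rw [List.map_cons, List.foldr_cons, ih, habsl]
  have hμ' : μ (t.eval 𝔸 ![a, b]) (t.eval 𝔸 ![a, c]) := hμ.eval t fun j => by
    fin_cases j
    · exact hμ.equiv.refl a
    · exact hbc
  simpa only [hfix] using h _ _ hμ'

theorem ConsistentMaps.iterate {V : Type} {A : V → Type} {P : CSP V A} {p : ∀ v, A v → A v}
    (hp : ConsistentMaps P p) (m : ℕ) : ConsistentMaps P fun v => (p v)^[m] := by
  intro C hC a ha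
  induction m with
  | zero => exact ha
  | succ m ih =>
    simp only [Function.iterate_succ_apply']
    exact hp C hC _ ih

/-- Finitely many self-maps of finite sets have a common idempotent iterate. -/
theorem exists_iterate_idempotent {V : Type} [Finite V] {A : V → Type} [∀ v, Finite (A v)]
    (q : ∀ v, A v → A v) :
    ∃ k, 1 ≤ k ∧ ∀ v x, (q v)^[k] ((q v)^[k] x) = (q v)^[k] x := by
  obtain ⟨i, j, hij, h⟩ :=
    Finite.exists_ne_map_eq_of_infinite fun (n : ℕ) (v : V) => (q v)^[n]
  wlog hlt : i < j generalizing i j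
  · exact this j i hij.symm h.symm (lt_of_le_of_ne (not_lt.1 hlt) hij.symm)
  obtain ⟨p, rfl⟩ := Nat.exists_eq_add_of_lt hlt
  have hper : ∀ v x n r, (q v)^[n + i + r * (p + 1)] x = (q v)^[n + i] x := by
    intro v x n r
    induction r with
    | zero => simp
    | succ r ih =>
      rw [show n + i + (r + 1) * (p + 1) = (n + r * (p + 1)) + (i + p + 1) by ring,
        Function.iterate_add_apply, ← congrFun h v, ← Function.iterate_add_apply,
        show n + r * (p + 1) + i = n + i + r * (p + 1) by ring, ih]
  refine ⟨(i + 1) * (p + 1), Nat.mul_pos i.succ_pos p.succ_pos, fun v x => ?_⟩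
  have hk : (i + 1) * (p + 1) = (i * p + p + 1) + i := by ring
  rw [← Function.iterate_add_apply]
  simpa only [← hk] using hper v x (i * p + p + 1) (i + 1)

/-- Lemma `lem:consistent-mapping`: given a multiplication term `x·y`
that is a semilattice operation on semilattice edges and with `a·b = a` or
`{a, a·b}` a semilattice edge, congruences `μ*_v` that are trivial or have
`(0_v : μ*_v) = 1_v`, a solution `φ` of `P/μ̄*` and representatives `b_v ∈ φ(v)`,
the iterates of `q_v(x) = x·b_v` are consistent mappings, some iterate is a family
of consistent idempotent mappings, and `q_v` does not depend on the choice of the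
representatives. -/
theorem maroti_consistent_mappings
    {σ : Signature} {V : Type} [Fintype V] {D : V → Type} [∀ v, Fintype (D v)]
    (𝔹 : ∀ v, AlgOn σ (D v)) (hIdem : ∀ v, (𝔹 v).Idem)
    (P : CSP V D) (hInv : ∀ C ∈ P.cons, C.Invariant 𝔹)
    (t : Term σ 2)
    (hsl : ∀ (v : V) (a b : D v), SemilatticeEdge (𝔹 v) a b →
      t.eval (𝔹 v) ![a, a] = a ∧ t.eval (𝔹 v) ![b, b] = b ∧
      t.eval (𝔹 v) ![a, b] = b ∧ t.eval (𝔹 v) ![b, a] = b)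
    (hmul : ∀ (v : V) (a b : D v),
      t.eval (𝔹 v) ![a, b] = a ∨ SemilatticeEdge (𝔹 v) a (t.eval (𝔹 v) ![a, b]))
    (μ : ∀ v, D v → D v → Prop) (hμ : ∀ v, IsCongruence (𝔹 v) (μ v))
    (hcen : ∀ v, μ v = Eq ∨ CentralizerCond (𝔹 v) Eq (μ v) (fullRel (D v)))
    (φ : ∀ v, Quotient (⟨μ v, (hμ v).equiv⟩ : Setoid (D v)))
    (hφ : (P.quot (fun v => (⟨μ v, (hμ v).equiv⟩ : Setoid (D v)))).IsSolution φ)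
    (b : ∀ v, D v) (hb : ∀ v, Quotient.mk (⟨μ v, (hμ v).equiv⟩ : Setoid (D v)) (b v) = φ v) :
    (∀ m : ℕ, 1 ≤ m →
      ConsistentMaps P (fun v => (fun x => t.eval (𝔹 v) ![x, b v])^[m])) ∧
    (∃ k : ℕ, 1 ≤ k ∧
      (∀ (v : V) (x : D v), (fun x => t.eval (𝔹 v) ![x, b v])^[k]
        ((fun x => t.eval (𝔹 v) ![x, b v])^[k] x) = (fun x => t.eval (𝔹 v) ![x, b v])^[k] x)
      ∧ ConsistentMaps P (fun v => (fun x => t.eval (𝔹 v) ![x, b v])^[k])) ∧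
    (∀ b' : ∀ v, D v,
      (∀ v, Quotient.mk (⟨μ v, (hμ v).equiv⟩ : Setoid (D v)) (b' v) = φ v) →
      ∀ (v : V) (x : D v), t.eval (𝔹 v) ![x, b v] = t.eval (𝔹 v) ![x, b' v]) := by
  have hid : ∀ (v : V) (a : D v), t.eval (𝔹 v) ![a, a] = a := fun v a =>
    (hmul v a a).elim id fun h => (hsl v _ _ h).1
  have habsl : ∀ (v : V) (a b : D v),
      t.eval (𝔹 v) ![a, t.eval (𝔹 v) ![a, b]] = t.eval (𝔹 v) ![a, b] := fun v a b =>
    (hmul v a b).elim (fun h => by rw [h, hid]) fun h => (hsl v _ _ h).2.2.1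
  have habsr : ∀ (v : V) (a b : D v),
      t.eval (𝔹 v) ![t.eval (𝔹 v) ![a, b], a] = t.eval (𝔹 v) ![a, b] := fun v a b =>
    (hmul v a b).elim (fun h => by rw [h, hid]) fun h => (hsl v _ _ h).2.2.2
  have hindep : ∀ (v : V) (x c d : D v), μ v c d →
      t.eval (𝔹 v) ![x, c] = t.eval (𝔹 v) ![x, d] := by
    intro v x c d hcd
    rcases hcen v with h | h
    · rw [h] at hcd
      rw [hcd]
    · exact eval_eq_of_centralizerCond (hid v) (habsl v) (habsr v) (hμ v) h x hcd
  have hcons : ConsistentMaps P fun v x => t.eval (𝔹 v) ![x, b v] := by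
    intro C hC a ha
    obtain ⟨c, hc, hφc⟩ := hφ _ (List.mem_map_of_mem hC)
    refine C.cyl _ _ ?_ (hInv C hC 2 t ![a, c] (Fin.forall_fin_two.2 ⟨ha, hc⟩))
    intro v hv
    have hbc : μ v (c v) (b v) := Quotient.exact ((hφc v hv).symm.trans (hb v).symm)
    refine Eq.trans ?_ (hindep v (a v) _ _ hbc)
    congr 1
    funext j
    fin_cases j <;> rfl
  refine ⟨fun m _ => hcons.iterate m, ?_, fun b' hb' v x =>
    hindep v x _ _ (Quotient.exact ((hb v).trans (hb' v).symm))⟩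
  obtain ⟨k, hk, hidk⟩ := exists_iterate_idempotent fun v x => t.eval (𝔹 v) ![x, b v]
  exact ⟨k, hk, hidk, hcons.iterate k⟩
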